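/- arXiv:1801.02792 — 5 statements merged into one kernel-verified Lean document; each statement's English description precedes it below -/
import Mathlib

section
/- Let l, β, m₀, m_l, k₀, k_l > 0 and let w : ℝ → ℝ be continuously differentiable on [0,l] (with continuous derivative w'). Set w₀ = w(0) and w_l = w(l). Then ∫₀^l w(x)² dx + m₀·w₀² + m_l·w_l² ≤ C₃·( β²·∫₀^l w'(x)² dx + k₀·w₀² + k_l·w_l² ), where C₃ = max{ (2l + m₀)/k₀ , m_l/k_l , 2l²/β² }. -/
open MeasureTheory in
theorem sq_intervalIntegral_le_mul_intervalIntegral_sq {a b : ℝ} (hab : a ≤ b) {f : ℝ → ℝ}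
    (hf : IntervalIntegrable f volume a b)
    (hf2 : IntervalIntegrable (fun x => f x ^ 2) volume a b) :
    (∫ x in a..b, f x) ^ 2 ≤ (b - a) * ∫ x in a..b, f x ^ 2 := by
  rcases hab.eq_or_lt with rfl | hlt
  · simp
  have hba : 0 < b - a := sub_pos.2 hlt
  set D := ∫ x in a..b, f x with hD
  set c := D / (b - a) with hc
  have hle : ∫ x in a..b, (2 * c * f x - c ^ 2) ≤ ∫ x in a..b, f x ^ 2 :=
    intervalIntegral.integral_mono_on hab ((hf.const_mul _).sub intervalIntegrable_const) hf2
      fun x _ => by nlinarith [sq_nonneg (f x - c)]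
  rw [intervalIntegral.integral_sub (hf.const_mul _) intervalIntegrable_const,
    intervalIntegral.integral_const_mul, intervalIntegral.integral_const, ← hD,
    smul_eq_mul] at hle
  calc D ^ 2 = (b - a) * (2 * c * D - (b - a) * c ^ 2) := by rw [hc]; field_simp; ring
    _ ≤ _ := mul_le_mul_of_nonneg_left hle hba.le

theorem sq_le_two_mul_sq_add_intervalIntegral_deriv_sq {l : ℝ} {w w' : ℝ → ℝ}
    (hderiv : ∀ x ∈ Set.Icc (0:ℝ) l, HasDerivAt w (w' x) x)
    (hcont : ContinuousOn w' (Set.Icc (0:ℝ) l)) {x : ℝ} (hx : x ∈ Set.Icc (0:ℝ) l) :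
    w x ^ 2 ≤ 2 * w 0 ^ 2 + 2 * l * ∫ t in (0:ℝ)..l, w' t ^ 2 := by
  have hl : 0 ≤ l := hx.1.trans hx.2
  have hsub : Set.Icc 0 x ⊆ Set.Icc 0 l := Set.Icc_subset_Icc_right hx.2
  have hint := (hcont.mono hsub).intervalIntegrable_of_Icc (μ := MeasureTheory.volume) hx.1
  have hint2 := ((hcont.mono hsub).pow 2).intervalIntegrable_of_Icc
    (μ := MeasureTheory.volume) hx.1
  have hftc : ∫ t in (0:ℝ)..x, w' t = w x - w 0 :=
    intervalIntegral.integral_eq_sub_of_hasDerivAt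
      (fun t ht => hderiv t (hsub (by rwa [Set.uIcc_of_le hx.1] at ht))) hint
  have hcs := sq_intervalIntegral_le_mul_intervalIntegral_sq hx.1 hint hint2
  have hmono : ∫ t in (0:ℝ)..x, w' t ^ 2 ≤ ∫ t in (0:ℝ)..l, w' t ^ 2 :=
    intervalIntegral.integral_mono_interval le_rfl hx.1 hx.2
      (Filter.Eventually.of_forall fun t => sq_nonneg (w' t))
      ((hcont.pow 2).intervalIntegrable_of_Icc hl)
  have hnonneg : 0 ≤ ∫ t in (0:ℝ)..x, w' t ^ 2 :=
    intervalIntegral.integral_nonneg hx.1 fun t _ => sq_nonneg (w' t)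
  rw [hftc, sub_zero] at hcs
  have hbound := hcs.trans (mul_le_mul hx.2 hmono hnonneg hl)
  nlinarith [sq_nonneg (w x - 2 * w 0)]

theorem intervalIntegral_sq_le_of_hasDerivAt {l : ℝ} (hl : 0 ≤ l) {w w' : ℝ → ℝ}
    (hderiv : ∀ x ∈ Set.Icc (0:ℝ) l, HasDerivAt w (w' x) x)
    (hcont : ContinuousOn w' (Set.Icc (0:ℝ) l)) :
    ∫ x in (0:ℝ)..l, w x ^ 2 ≤ 2 * l * w 0 ^ 2 + 2 * l ^ 2 * ∫ x in (0:ℝ)..l, w' x ^ 2 := by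
  have hw : ContinuousOn w (Set.Icc 0 l) := fun x hx =>
    (hderiv x hx).continuousAt.continuousWithinAt
  have hle := intervalIntegral.integral_mono_on hl
    ((hw.pow 2).intervalIntegrable_of_Icc (μ := MeasureTheory.volume) hl)
    intervalIntegrable_const
    fun x hx => sq_le_two_mul_sq_add_intervalIntegral_deriv_sq hderiv hcont hx
  rw [intervalIntegral.integral_const, smul_eq_mul, sub_zero] at hle
  exact hle.trans_eq (by ring)

theorem stmt_4 (l β m₀ ml k₀ kl : ℝ)
    (hl : 0 < l) (hβ : 0 < β) (hm₀ : 0 < m₀) (hml : 0 < ml)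
    (hk₀ : 0 < k₀) (hkl : 0 < kl) (w w' : ℝ → ℝ)
    (hderiv : ∀ x ∈ Set.Icc (0:ℝ) l, HasDerivAt w (w' x) x)
    (hcont : ContinuousOn w' (Set.Icc (0:ℝ) l)) :
    (∫ x in (0:ℝ)..l, (w x) ^ 2) + m₀ * (w 0) ^ 2 + ml * (w l) ^ 2 ≤
      max (max ((2 * l + m₀) / k₀) (ml / kl)) (2 * l ^ 2 / β ^ 2) *
        (β ^ 2 * (∫ x in (0:ℝ)..l, (w' x) ^ 2) + k₀ * (w 0) ^ 2 + kl * (w l) ^ 2) := by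
  have hint := intervalIntegral_sq_le_of_hasDerivAt hl.le hderiv hcont
  have hnonneg : 0 ≤ ∫ x in (0:ℝ)..l, w' x ^ 2 :=
    intervalIntegral.integral_nonneg hl.le fun x _ => sq_nonneg (w' x)
  set C := max (max ((2 * l + m₀) / k₀) (ml / kl)) (2 * l ^ 2 / β ^ 2)
  have h₀ : 2 * l + m₀ ≤ C * k₀ :=
    (div_le_iff₀ hk₀).1 ((le_max_left _ _).trans (le_max_left _ _))
  have hₗ : ml ≤ C * kl := (div_le_iff₀ hkl).1 ((le_max_right _ _).trans (le_max_left _ _))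
  have hd : 2 * l ^ 2 ≤ C * β ^ 2 := (div_le_iff₀ (by positivity)).1 (le_max_right _ _)
  linarith [mul_le_mul_of_nonneg_right h₀ (sq_nonneg (w 0)),
    mul_le_mul_of_nonneg_right hₗ (sq_nonneg (w l)), mul_le_mul_of_nonneg_right hd hnonneg]
end

section
/- Let l, β, k₀, k_l, γ, α₀ > 0. Then there exists a constant C > 0 such that for every function w : ℝ → ℝ that is continuously differentiable on [0,l] (with continuous derivative w'), β²·∫₀^l w'(x)² dx + k₀·w(0)² + k_l·w(l)² ≤ C·( γ·∫₀^l w'(x)² dx + α₀·w(0)² ). -/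
/-- Cauchy–Schwarz on `[0, l]` against the constant function one. -/
theorem sq_intervalIntegral_le {l : ℝ} (hl : 0 < l) {f : ℝ → ℝ}
    (hf : ContinuousOn f (Set.Icc (0:ℝ) l)) :
    (∫ x in (0:ℝ)..l, f x) ^ 2 ≤ l * ∫ x in (0:ℝ)..l, (f x) ^ 2 := by
  set D := ∫ x in (0:ℝ)..l, f x with hD
  have hf' : ContinuousOn f (Set.uIcc (0:ℝ) l) := by rwa [Set.uIcc_of_le hl.le]
  have hi : IntervalIntegrable f MeasureTheory.volume 0 l := hf'.intervalIntegrable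
  have hi2 : IntervalIntegrable (fun x => (f x) ^ 2) MeasureTheory.volume 0 l :=
    (hf'.pow 2).intervalIntegrable
  have hnonneg : 0 ≤ ∫ x in (0:ℝ)..l, (f x - D / l) ^ 2 :=
    intervalIntegral.integral_nonneg hl.le fun x _ => sq_nonneg _
  have hexpand : (∫ x in (0:ℝ)..l, (f x - D / l) ^ 2) =
      (∫ x in (0:ℝ)..l, (f x) ^ 2) - 2 * (D / l) * D + l * (D / l) ^ 2 := by
    have h : ∀ x, (f x - D / l) ^ 2 = (f x) ^ 2 - 2 * (D / l) * f x + (D / l) ^ 2 :=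
      fun x => by ring
    simp_rw [h]
    rw [intervalIntegral.integral_add (hi2.sub (hi.const_mul _)) intervalIntegrable_const,
      intervalIntegral.integral_sub hi2 (hi.const_mul _),
      intervalIntegral.integral_const_mul, intervalIntegral.integral_const, ← hD]
    simp
  rw [hexpand] at hnonneg
  have hmul := mul_nonneg hl.le hnonneg
  have hcancel : l * (D / l) = D := by field_simp
  linear_combination hmul + (l * (D / l) - D) * hcancel

theorem stmt_6 (l β k₀ kl γ α₀ : ℝ)
    (hl : 0 < l) (hβ : 0 < β) (hk₀ : 0 < k₀) (hkl : 0 < kl)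
    (hγ : 0 < γ) (hα₀ : 0 < α₀) :
    ∃ C : ℝ, 0 < C ∧ ∀ w w' : ℝ → ℝ,
      (∀ x ∈ Set.Icc (0:ℝ) l, HasDerivAt w (w' x) x) →
      ContinuousOn w' (Set.Icc (0:ℝ) l) →
      β ^ 2 * (∫ x in (0:ℝ)..l, (w' x) ^ 2) + k₀ * (w 0) ^ 2 + kl * (w l) ^ 2 ≤
        C * (γ * (∫ x in (0:ℝ)..l, (w' x) ^ 2) + α₀ * (w 0) ^ 2) := by
  refine ⟨(β ^ 2 + 2 * kl * l) / γ + (k₀ + 2 * kl) / α₀, by positivity, ?_⟩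
  intro w w' hw hw'
  have hftc : (∫ x in (0:ℝ)..l, w' x) = w l - w 0 := by
    apply intervalIntegral.integral_eq_sub_of_hasDerivAt
    · rwa [Set.uIcc_of_le hl.le]
    · apply ContinuousOn.intervalIntegrable
      rwa [Set.uIcc_of_le hl.le]
  have hcs := sq_intervalIntegral_le hl hw'
  rw [hftc] at hcs
  have hI : 0 ≤ ∫ x in (0:ℝ)..l, (w' x) ^ 2 :=
    intervalIntegral.integral_nonneg hl.le fun x _ => sq_nonneg _
  generalize (∫ x in (0:ℝ)..l, (w' x) ^ 2) = I at *
  have htrace : (w l) ^ 2 ≤ 2 * (w 0) ^ 2 + 2 * (l * I) := by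
    nlinarith [sq_nonneg (w l - 2 * w 0)]
  have hcross₁ : 0 ≤ (β ^ 2 + 2 * kl * l) / γ * (α₀ * (w 0) ^ 2) := by positivity
  have hcross₂ : 0 ≤ (k₀ + 2 * kl) / α₀ * (γ * I) := by positivity
  have hdiag₁ : (β ^ 2 + 2 * kl * l) / γ * (γ * I) = (β ^ 2 + 2 * kl * l) * I := by
    field_simp
  have hdiag₂ : (k₀ + 2 * kl) / α₀ * (α₀ * (w 0) ^ 2) = (k₀ + 2 * kl) * (w 0) ^ 2 := by
    field_simp
  have hscaled := mul_le_mul_of_nonneg_left htrace hkl.le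
  linear_combination hscaled + hcross₁ + hcross₂ - hdiag₁ - hdiag₂
end

section
/- Let l, β, k₀, k_l, γ, α > 0. Then there exists a constant C₃ > 0 such that for every function w : ℝ → ℝ that is continuously differentiable on [0,l] (with continuous derivative w'), β²·∫₀^l w'(x)² dx + k₀·w(0)² + k_l·w(l)² ≤ C₃·( γ·∫₀^l w'(x)² dx + α·∫₀^l w(x)² dx ). -/
/-- A weighted trace inequality on `[0, l]`, obtained by integrating the derivative of
`x ↦ (x - c) * w x ^ 2`. -/
theorem weighted_boundary_sq_le {l c : ℝ} (hc₀ : 0 ≤ c) (hcl : c ≤ l) {w w' : ℝ → ℝ}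
    (hw : ∀ x ∈ Set.Icc (0 : ℝ) l, HasDerivAt w (w' x) x)
    (hw' : ContinuousOn w' (Set.Icc (0 : ℝ) l)) :
    (l - c) * w l ^ 2 + c * w 0 ^ 2 ≤
      (1 + l) * (∫ x in (0 : ℝ)..l, w x ^ 2) + l * ∫ x in (0 : ℝ)..l, w' x ^ 2 := by
  have hl : 0 ≤ l := hc₀.trans hcl
  have hwc : ContinuousOn w (Set.Icc (0 : ℝ) l) := fun x hx =>
    (hw x hx).continuousAt.continuousWithinAt
  rw [← Set.uIcc_of_le hl] at hwc hw'
  have hA : IntervalIntegrable (fun x => w x ^ 2) MeasureTheory.volume 0 l :=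
    (hwc.pow 2).intervalIntegrable
  have hB : IntervalIntegrable (fun x => w' x ^ 2) MeasureTheory.volume 0 l :=
    (hw'.pow 2).intervalIntegrable
  have hF : IntervalIntegrable (fun x => w x ^ 2 + (x - c) * (2 * w x * w' x))
      MeasureTheory.volume 0 l := by
    apply ContinuousOn.intervalIntegrable
    fun_prop
  have hFTC : ∫ x in (0 : ℝ)..l, (w x ^ 2 + (x - c) * (2 * w x * w' x)) =
      (l - c) * w l ^ 2 - (0 - c) * w 0 ^ 2 := by
    refine intervalIntegral.integral_eq_sub_of_hasDerivAt
      (f := fun x => (x - c) * w x ^ 2) (fun x hx => ?_) hF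
    rw [Set.uIcc_of_le hl] at hx
    refine (((hasDerivAt_id x).sub_const c).mul ((hw x hx).pow 2)).congr_deriv ?_
    simp
  have hle : ∫ x in (0 : ℝ)..l, (w x ^ 2 + (x - c) * (2 * w x * w' x)) ≤
      ∫ x in (0 : ℝ)..l, ((1 + l) * w x ^ 2 + l * w' x ^ 2) := by
    refine intervalIntegral.integral_mono_on hl hF ((hA.const_mul _).add (hB.const_mul _))
      fun x hx => ?_
    have h₁ : 0 ≤ l - (x - c) := by linarith [hx.2]
    have h₂ : 0 ≤ l + (x - c) := by linarith [hx.1]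
    nlinarith [mul_nonneg h₁ (sq_nonneg (w x - w' x)), mul_nonneg h₂ (sq_nonneg (w x + w' x)),
      mul_nonneg h₁ (sq_nonneg (w x + w' x)), mul_nonneg h₂ (sq_nonneg (w x - w' x))]
  rw [intervalIntegral.integral_add (hA.const_mul _) (hB.const_mul _),
    intervalIntegral.integral_const_mul, intervalIntegral.integral_const_mul, hFTC] at hle
  linarith

theorem stmt_8 (l β k₀ kl γ α : ℝ)
    (hl : 0 < l) (hβ : 0 < β) (hk₀ : 0 < k₀) (hkl : 0 < kl)
    (hγ : 0 < γ) (hα : 0 < α) :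
    ∃ C₃ : ℝ, 0 < C₃ ∧ ∀ w w' : ℝ → ℝ,
      (∀ x ∈ Set.Icc (0:ℝ) l, HasDerivAt w (w' x) x) →
      ContinuousOn w' (Set.Icc (0:ℝ) l) →
      β ^ 2 * (∫ x in (0:ℝ)..l, (w' x) ^ 2) + k₀ * (w 0) ^ 2 + kl * (w l) ^ 2 ≤
        C₃ * (γ * (∫ x in (0:ℝ)..l, (w' x) ^ 2) + α * ∫ x in (0:ℝ)..l, (w x) ^ 2) := by
  refine ⟨(β ^ 2 + (k₀ + kl)) / γ + (k₀ + kl) * (1 + l) / l / α, by positivity,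
    fun w w' hw hw' => ?_⟩
  have h₀ := weighted_boundary_sq_le hl.le le_rfl hw hw'
  have h₁ := weighted_boundary_sq_le le_rfl hl.le hw hw'
  have hA : 0 ≤ ∫ x in (0 : ℝ)..l, w x ^ 2 :=
    intervalIntegral.integral_nonneg hl.le fun x _ => sq_nonneg _
  have hB : 0 ≤ ∫ x in (0 : ℝ)..l, w' x ^ 2 :=
    intervalIntegral.integral_nonneg hl.le fun x _ => sq_nonneg _
  generalize (∫ x in (0 : ℝ)..l, w x ^ 2) = A at *
  generalize (∫ x in (0 : ℝ)..l, w' x ^ 2) = B at *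
  have hbound : ∀ y : ℝ, l * y ≤ (1 + l) * A + l * B → y ≤ (1 + l) / l * A + B := by
    intro y hy
    have h : (1 + l) / l * A + B = ((1 + l) * A + l * B) / l := by field_simp
    rw [h, le_div_iff₀ hl]
    linarith
  calc β ^ 2 * B + k₀ * w 0 ^ 2 + kl * w l ^ 2
      ≤ β ^ 2 * B + k₀ * ((1 + l) / l * A + B) + kl * ((1 + l) / l * A + B) := by
        gcongr
        · exact hbound _ (by linarith)
        · exact hbound _ (by linarith)
    _ = (β ^ 2 + (k₀ + kl)) / γ * (γ * B) + (k₀ + kl) * (1 + l) / l / α * (α * A) := by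
        field_simp
        ring
    _ ≤ (β ^ 2 + (k₀ + kl)) / γ * (γ * B + α * A) +
          (k₀ + kl) * (1 + l) / l / α * (γ * B + α * A) := by
        gcongr
        · exact le_add_of_nonneg_right (by positivity)
        · exact le_add_of_nonneg_left (by positivity)
    _ = _ := by ring
end

section
/- Let l, β, k₀, k_l > 0 and γ, α, α₀, α_l ≥ 0. Then there exists a constant c₁ > 0 such that for all functions w, p : ℝ → ℝ that are continuously differentiable on [0,l], | γ·∫₀^l w'(x) p'(x) dx + α·∫₀^l w(x) p(x) dx + α₀·w(0)·p(0) + α_l·w(l)·p(l) | ≤ c₁ · ( β²·∫₀^l w'(x)² dx + k₀·w(0)² + k_l·w(l)² )^{1/2} · ( β²·∫₀^l p'(x)² dx + k₀·p(0)² + k_l·p(l)² )^{1/2}. -/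
theorem sq_intervalIntegral_mul_le {a b : ℝ} (hab : a ≤ b) {f g : ℝ → ℝ}
    (hf : ContinuousOn f (Set.Icc a b)) (hg : ContinuousOn g (Set.Icc a b)) :
    (∫ x in a..b, f x * g x) ^ 2 ≤ (∫ x in a..b, f x ^ 2) * ∫ x in a..b, g x ^ 2 := by
  have hff : IntervalIntegrable (fun x => f x ^ 2) MeasureTheory.volume a b :=
    (hf.pow 2).intervalIntegrable_of_Icc hab
  have hgg : IntervalIntegrable (fun x => g x ^ 2) MeasureTheory.volume a b :=
    (hg.pow 2).intervalIntegrable_of_Icc hab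
  have hfg : IntervalIntegrable (fun x => f x * g x) MeasureTheory.volume a b :=
    (hf.mul hg).intervalIntegrable_of_Icc hab
  have key : ∀ t : ℝ, 0 ≤ (∫ x in a..b, f x ^ 2) * (t * t) +
      (2 * ∫ x in a..b, f x * g x) * t + ∫ x in a..b, g x ^ 2 := by
    intro t
    have h : 0 ≤ ∫ x in a..b, (t * f x + g x) ^ 2 :=
      intervalIntegral.integral_nonneg hab fun x _ => sq_nonneg _
    have e : (∫ x in a..b, (t * f x + g x) ^ 2) =
        ∫ x in a..b, (t ^ 2 * f x ^ 2 + 2 * t * (f x * g x) + g x ^ 2) := by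
      congr 1
      ext x
      ring
    rw [e, intervalIntegral.integral_add ((hff.const_mul _).add (hfg.const_mul _)) hgg,
      intervalIntegral.integral_add (hff.const_mul _) (hfg.const_mul _),
      intervalIntegral.integral_const_mul, intervalIntegral.integral_const_mul] at h
    linarith
  have := discrim_le_zero key
  rw [discrim] at this
  linarith

theorem sq_le_sq_add_integral_deriv_sq {l : ℝ} {w w' : ℝ → ℝ}
    (hw : ∀ x ∈ Set.Icc (0 : ℝ) l, HasDerivAt w (w' x) x)
    (hw' : ContinuousOn w' (Set.Icc (0 : ℝ) l)) {x : ℝ} (hx : x ∈ Set.Icc (0 : ℝ) l) :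
    w x ^ 2 ≤ 2 * w 0 ^ 2 + 2 * l * ∫ y in (0 : ℝ)..l, w' y ^ 2 := by
  have hsub : Set.Icc 0 x ⊆ Set.Icc 0 l := Set.Icc_subset_Icc_right hx.2
  have hc := hw'.mono hsub
  have ftc : ∫ y in (0 : ℝ)..x, w' y = w x - w 0 := by
    apply intervalIntegral.integral_eq_sub_of_hasDerivAt
    · intro y hy
      rw [Set.uIcc_of_le hx.1] at hy
      exact hw y (hsub hy)
    · exact hc.intervalIntegrable_of_Icc hx.1
  have cs := sq_intervalIntegral_mul_le hx.1 hc (continuousOn_const (c := (1 : ℝ)))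
  simp only [mul_one, one_pow, intervalIntegral.integral_const, sub_zero, smul_eq_mul] at cs
  rw [ftc] at cs
  have mono : ∫ y in (0 : ℝ)..x, w' y ^ 2 ≤ ∫ y in (0 : ℝ)..l, w' y ^ 2 :=
    intervalIntegral.integral_mono_interval le_rfl hx.1 hx.2
      (Filter.Eventually.of_forall fun y => sq_nonneg (w' y))
      ((hw'.pow 2).intervalIntegrable_of_Icc (hx.1.trans hx.2))
  have hnn : 0 ≤ ∫ y in (0 : ℝ)..x, w' y ^ 2 :=
    intervalIntegral.integral_nonneg hx.1 fun y _ => sq_nonneg _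
  have : (∫ y in (0 : ℝ)..x, w' y ^ 2) * x ≤ (∫ y in (0 : ℝ)..l, w' y ^ 2) * l :=
    mul_le_mul mono hx.2 hx.1 (hnn.trans mono)
  nlinarith [sq_nonneg (w x - 2 * w 0)]

theorem integral_sq_le_sq_add_integral_deriv_sq {l : ℝ} (hl : 0 ≤ l) {w w' : ℝ → ℝ}
    (hw : ∀ x ∈ Set.Icc (0 : ℝ) l, HasDerivAt w (w' x) x)
    (hw' : ContinuousOn w' (Set.Icc (0 : ℝ) l)) :
    ∫ x in (0 : ℝ)..l, w x ^ 2 ≤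
      2 * l * w 0 ^ 2 + 2 * l ^ 2 * ∫ y in (0 : ℝ)..l, w' y ^ 2 := by
  have hc : ContinuousOn w (Set.Icc 0 l) := fun x hx => (hw x hx).continuousAt.continuousWithinAt
  have h := intervalIntegral.integral_mono_on (μ := MeasureTheory.volume) hl
    ((hc.pow 2).intervalIntegrable_of_Icc hl)
    intervalIntegrable_const fun x hx => sq_le_sq_add_integral_deriv_sq hw hw' hx
  simp only [Pi.pow_apply, intervalIntegral.integral_const, sub_zero, smul_eq_mul] at h
  linarith

theorem abs_le_mul_sqrt_mul_sqrt {a b c K N M : ℝ} (hc : 0 ≤ c) (hK : 0 ≤ K)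
    (hN : 0 ≤ N) (hM : 0 ≤ M) (h : a ^ 2 ≤ b * c) (hbN : b ≤ K * N) (hcM : c ≤ K * M) :
    |a| ≤ K * (√N * √M) := by
  apply abs_le_of_sq_le_sq _ (by positivity)
  rw [mul_pow, mul_pow, Real.sq_sqrt hN, Real.sq_sqrt hM]
  calc a ^ 2 ≤ b * c := h
    _ ≤ (K * N) * (K * M) := mul_le_mul hbN hcM hc (by positivity)
    _ = K ^ 2 * (N * M) := by ring

theorem sq_bounds_of_energy {l β k₀ kl : ℝ} (hl : 0 < l) (hβ : 0 < β) (hk₀ : 0 < k₀)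
    (hkl : 0 < kl) {w w' : ℝ → ℝ} (hw : ∀ x ∈ Set.Icc (0 : ℝ) l, HasDerivAt w (w' x) x)
    (hw' : ContinuousOn w' (Set.Icc (0 : ℝ) l)) {N : ℝ}
    (hN : N = β ^ 2 * (∫ x in (0 : ℝ)..l, w' x ^ 2) + k₀ * w 0 ^ 2 + kl * w l ^ 2) :
    0 ≤ N ∧ ∫ x in (0 : ℝ)..l, w' x ^ 2 ≤ 1 / β ^ 2 * N ∧
      ∫ x in (0 : ℝ)..l, w x ^ 2 ≤ (2 * l / k₀ + 2 * l ^ 2 / β ^ 2) * N ∧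
      w 0 ^ 2 ≤ 1 / k₀ * N ∧ w l ^ 2 ≤ 1 / kl * N := by
  have hA : 0 ≤ ∫ x in (0 : ℝ)..l, w' x ^ 2 :=
    intervalIntegral.integral_nonneg hl.le fun x _ => sq_nonneg _
  have hP := integral_sq_le_sq_add_integral_deriv_sq hl.le hw hw'
  have h1 : 0 ≤ β ^ 2 * ∫ x in (0 : ℝ)..l, w' x ^ 2 := by positivity
  have h2 : 0 ≤ k₀ * w 0 ^ 2 := by positivity
  have h3 : 0 ≤ kl * w l ^ 2 := by positivity
  have b1 : ∫ x in (0 : ℝ)..l, w' x ^ 2 ≤ 1 / β ^ 2 * N := by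
    rw [one_div_mul_eq_div, le_div_iff₀ (by positivity)]
    linarith
  have b2 : w 0 ^ 2 ≤ 1 / k₀ * N := by
    rw [one_div_mul_eq_div, le_div_iff₀ hk₀]
    linarith
  have b3 : w l ^ 2 ≤ 1 / kl * N := by
    rw [one_div_mul_eq_div, le_div_iff₀ hkl]
    linarith
  refine ⟨by linarith, b1, ?_, b2, b3⟩
  calc ∫ x in (0 : ℝ)..l, w x ^ 2
      ≤ 2 * l * w 0 ^ 2 + 2 * l ^ 2 * ∫ y in (0 : ℝ)..l, w' y ^ 2 := hP
    _ ≤ 2 * l * (1 / k₀ * N) + 2 * l ^ 2 * (1 / β ^ 2 * N) := by gcongr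
    _ = (2 * l / k₀ + 2 * l ^ 2 / β ^ 2) * N := by ring

theorem stmt_9 (l β k₀ kl γ α α₀ αl : ℝ)
    (hl : 0 < l) (hβ : 0 < β) (hk₀ : 0 < k₀) (hkl : 0 < kl)
    (hγ : 0 ≤ γ) (hα : 0 ≤ α) (hα₀ : 0 ≤ α₀) (hαl : 0 ≤ αl) :
    ∃ c₁ : ℝ, 0 < c₁ ∧ ∀ w w' p p' : ℝ → ℝ,
      (∀ x ∈ Set.Icc (0:ℝ) l, HasDerivAt w (w' x) x) →
      ContinuousOn w' (Set.Icc (0:ℝ) l) →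
      (∀ x ∈ Set.Icc (0:ℝ) l, HasDerivAt p (p' x) x) →
      ContinuousOn p' (Set.Icc (0:ℝ) l) →
      |γ * (∫ x in (0:ℝ)..l, w' x * p' x) + α * (∫ x in (0:ℝ)..l, w x * p x) +
          α₀ * (w 0 * p 0) + αl * (w l * p l)| ≤
        c₁ * Real.sqrt (β ^ 2 * (∫ x in (0:ℝ)..l, (w' x) ^ 2) + k₀ * (w 0) ^ 2 + kl * (w l) ^ 2)
          * Real.sqrt (β ^ 2 * (∫ x in (0:ℝ)..l, (p' x) ^ 2) + k₀ * (p 0) ^ 2 + kl * (p l) ^ 2) := by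
  refine ⟨γ * (1 / β ^ 2) + α * (2 * l / k₀ + 2 * l ^ 2 / β ^ 2) + α₀ * (1 / k₀) +
    αl * (1 / kl) + 1, by positivity, ?_⟩
  intro w w' p p' hw hw' hp hp'
  obtain ⟨hN, hN1, hN2, hN3, hN4⟩ := sq_bounds_of_energy hl hβ hk₀ hkl hw hw' rfl
  obtain ⟨hM, hM1, hM2, hM3, hM4⟩ := sq_bounds_of_energy hl hβ hk₀ hkl hp hp' rfl
  set N := β ^ 2 * (∫ x in (0 : ℝ)..l, (w' x) ^ 2) + k₀ * (w 0) ^ 2 + kl * (w l) ^ 2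
  set M := β ^ 2 * (∫ x in (0 : ℝ)..l, (p' x) ^ 2) + k₀ * (p 0) ^ 2 + kl * (p l) ^ 2
  have hcw : ContinuousOn w (Set.Icc 0 l) := fun x hx => (hw x hx).continuousAt.continuousWithinAt
  have hcp : ContinuousOn p (Set.Icc 0 l) := fun x hx => (hp x hx).continuousAt.continuousWithinAt
  have t1 := abs_le_mul_sqrt_mul_sqrt
    (intervalIntegral.integral_nonneg hl.le fun x _ => sq_nonneg (p' x)) (by positivity) hN hM
    (sq_intervalIntegral_mul_le hl.le hw' hp') hN1 hM1
  have t2 := abs_le_mul_sqrt_mul_sqrt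
    (intervalIntegral.integral_nonneg hl.le fun x _ => sq_nonneg (p x)) (by positivity) hN hM
    (sq_intervalIntegral_mul_le hl.le hcw hcp) hN2 hM2
  have t3 := abs_le_mul_sqrt_mul_sqrt (sq_nonneg (p 0)) (by positivity) hN hM
    (mul_pow (w 0) (p 0) 2).le hN3 hM3
  have t4 := abs_le_mul_sqrt_mul_sqrt (sq_nonneg (p l)) (by positivity) hN hM
    (mul_pow (w l) (p l) 2).le hN4 hM4
  have hS : 0 ≤ √N * √M := by positivity
  rw [mul_assoc _ √N √M]
  set S := √N * √M
  calc _ ≤ |γ * (∫ x in (0 : ℝ)..l, w' x * p' x)| + |α * (∫ x in (0 : ℝ)..l, w x * p x)| +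
        |α₀ * (w 0 * p 0)| + |αl * (w l * p l)| :=
        (abs_add_le _ _).trans (by gcongr; exact abs_add_three _ _ _)
    _ = γ * |∫ x in (0 : ℝ)..l, w' x * p' x| + α * |∫ x in (0 : ℝ)..l, w x * p x| +
        α₀ * |w 0 * p 0| + αl * |w l * p l| := by
      rw [abs_mul γ, abs_mul α, abs_mul α₀, abs_mul αl, abs_of_nonneg hγ, abs_of_nonneg hα,
        abs_of_nonneg hα₀, abs_of_nonneg hαl]
    _ ≤ γ * (1 / β ^ 2 * S) + α * ((2 * l / k₀ + 2 * l ^ 2 / β ^ 2) * S) +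
        α₀ * (1 / k₀ * S) + αl * (1 / kl * S) := by gcongr
    _ ≤ _ := by linarith
end

section
/- Let l > 0, β, m₀, m_l, k₀, k_l, k₃ > 0 and γ, α, α₀, α_l ≥ 0. Let w : ℝ × ℝ → ℝ be three times continuously differentiable on ℝ × [0,l], write w₀(t) = w(t,0) and w_l(t) = w(t,l), and suppose that for all t ∈ ℝ: (i) w_tt(t,x) + α w_t(t,x) = γ w_txx(t,x) + β² w_xx(t,x) for all x ∈ [0,l]; (ii) m₀ ẅ₀(t) + α₀ ẇ₀(t) + k₀ w₀(t) = γ w_tx(t,0) + β² w_x(t,0); (iii) m_l ẅ_l(t) + α_l ẇ_l(t) + k_l w_l(t) = −γ w_tx(t,l) − β² w_x(t,l) − k₃ (w_l(t))³. Define the energy E(t) = (1/2)∫₀^l w_t(t,x)² dx + (m_l/2)(ẇ_l(t))² + (m₀/2)(ẇ₀(t))² + (β²/2)∫₀^l w_x(t,x)² dx + (k_l/2)(w_l(t))² + (k₀/2)(w₀(t))² + (k₃/4)(w_l(t))⁴. Then E is differentiable and for every t, E'(t) = −( γ·∫₀^l w_tx(t,x)² dx + α·∫₀^l w_t(t,x)²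 dx + α₀·(ẇ₀(t))² + α_l·(ẇ_l(t))² ); in particular E'(t) ≤ 0, so E is non-increasing. -/
/-- Differentiation under the integral sign for a `t`-derivative that is jointly continuous on
the strip over a compact interval. -/
theorem hasDerivAt_intervalIntegral_of_continuousOn_deriv {f f' : ℝ → ℝ → ℝ} {a b : ℝ}
    (hf : ∀ t, ContinuousOn (f t) (Set.uIcc a b))
    (hf' : ContinuousOn (fun q : ℝ × ℝ => f' q.1 q.2) (Set.univ ×ˢ Set.uIcc a b))
    (hd : ∀ t, ∀ x ∈ Set.uIcc a b, HasDerivAt (fun s => f s x) (f' t x) t) (t : ℝ) :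
    HasDerivAt (fun s => ∫ x in a..b, f s x) (∫ x in a..b, f' t x) t := by
  obtain ⟨C, hC⟩ := ((isCompact_Icc (a := t - 1) (b := t + 1)).prod
    (isCompact_uIcc (a := a) (b := b))).exists_bound_of_continuousOn
      (hf'.mono (Set.prod_mono_left (Set.subset_univ _)))
  have hslice : ContinuousOn (f' t) (Set.uIcc a b) :=
    hf'.comp (f := fun x => (t, x)) (by fun_prop) fun x hx => ⟨Set.mem_univ _, hx⟩
  refine (intervalIntegral.hasDerivAt_integral_of_dominated_loc_of_deriv_le
    (bound := fun _ => C) (Icc_mem_nhds (sub_one_lt t) (lt_add_one t))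
    (.of_forall fun s => ?_) (hf t).intervalIntegrable ?_ (.of_forall fun x hx s hs => ?_)
    intervalIntegrable_const (.of_forall fun x hx s _ => ?_)).2
  · exact ((hf s).mono Set.uIoc_subset_uIcc).aestronglyMeasurable measurableSet_uIoc
  · exact (hslice.mono Set.uIoc_subset_uIcc).aestronglyMeasurable measurableSet_uIoc
  · exact hC (s, x) ⟨hs, Set.uIoc_subset_uIcc hx⟩
  · exact hd s x (Set.uIoc_subset_uIcc hx)

/-- Symmetry of mixed partial derivatives on a strip: if `w_tx` exists and is jointly continuous,
then it is also the `t`-derivative of `w_x`. -/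
theorem hasDerivAt_swap_mixed_partial {l : ℝ} (hl : 0 < l) {w wt wx wtx : ℝ → ℝ → ℝ}
    (hwt : ∀ t, ∀ x ∈ Set.Icc 0 l, HasDerivAt (fun s => w s x) (wt t x) t)
    (hwx : ∀ t, ∀ x ∈ Set.Icc 0 l, HasDerivAt (fun y => w t y) (wx t x) x)
    (hwtx : ∀ t, ∀ x ∈ Set.Icc 0 l, HasDerivAt (fun y => wt t y) (wtx t x) x)
    (hcwt : ContinuousOn (fun q : ℝ × ℝ => wt q.1 q.2) (Set.univ ×ˢ Set.Icc 0 l))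
    (hcwtx : ContinuousOn (fun q : ℝ × ℝ => wtx q.1 q.2) (Set.univ ×ˢ Set.Icc 0 l))
    (t : ℝ) {x : ℝ} (hx : x ∈ Set.Icc 0 l) :
    HasDerivAt (fun s => wx s x) (wtx t x) t := by
  have hcol {g : ℝ → ℝ → ℝ} (hg : ContinuousOn (fun q : ℝ × ℝ => g q.1 q.2)
      (Set.univ ×ˢ Set.Icc 0 l)) {y : ℝ} (hy : y ∈ Set.Icc 0 l) : Continuous fun τ => g τ y :=
    hg.comp_continuous (f := fun τ => (τ, y)) (by fun_prop) fun τ => ⟨Set.mem_univ _, hy⟩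
  set G : ℝ → ℝ → ℝ := fun τ y => wtx τ (Set.projIcc 0 l hl.le y) with hG
  have hGeq (τ : ℝ) {y : ℝ} (hy : y ∈ Set.Icc 0 l) : G τ y = wtx τ y := by
    simp only [hG, Set.projIcc_of_mem hl.le hy]
  have hGc : Continuous fun q : ℝ × ℝ => G q.1 q.2 :=
    hcwtx.comp_continuous
      (f := fun q : ℝ × ℝ => (q.1, (Set.projIcc 0 l hl.le q.2 : ℝ)))
      (continuous_fst.prodMk
        (continuous_subtype_val.comp (continuous_projIcc.comp continuous_snd)))
      fun q => ⟨Set.mem_univ _, Subtype.coe_prop _⟩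
  have hGrow (τ : ℝ) : Continuous (G τ) := hGc.comp (f := fun y => (τ, y)) (by fun_prop)
  have h0 : (0 : ℝ) ∈ Set.Icc 0 l := ⟨le_rfl, hl.le⟩
  set V : ℝ → ℝ → ℝ := fun y τ => wt τ 0 + ∫ z in (0 : ℝ)..y, G τ z with hV
  have hVeq (τ : ℝ) {y : ℝ} (hy : y ∈ Set.Icc 0 l) : V y τ = wt τ y := by
    have hsub : Set.uIcc 0 y ⊆ Set.Icc 0 l := Set.uIcc_subset_Icc h0 hy
    have := intervalIntegral.integral_eq_sub_of_hasDerivAt (a := 0) (b := y)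
      (f := fun z => wt τ z) (f' := G τ)
      (fun z hz => by rw [hGeq τ (hsub hz)]; exact hwtx τ z (hsub hz))
      ((hGrow τ).intervalIntegrable _ _)
    simp only [hV, this]
    ring
  have hVc (y : ℝ) : Continuous (V y) :=
    (hcol hcwt h0).add
      (intervalIntegral.continuous_parametric_intervalIntegral_of_continuous' hGc 0 y)
  have hVd (y τ : ℝ) : HasDerivAt (fun y => V y τ) (G τ y) y :=
    ((hGrow τ).integral_hasStrictDerivAt 0 y).hasDerivAt.const_add _
  have hincr (s : ℝ) : wx s x = wx t x + ∫ τ in t..s, wtx τ x := by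
    have hW := hasDerivAt_intervalIntegral_of_continuousOn_deriv (f := V)
      (f' := fun y τ => G τ y) (a := t) (b := s) (fun y => (hVc y).continuousOn)
      (hGc.comp continuous_swap).continuousOn (fun y τ _ => hVd y τ) x
    have hWeq {y : ℝ} (hy : y ∈ Set.Icc 0 l) : w s y - w t y = ∫ τ in t..s, V y τ := by
      simp only [hVeq _ hy]
      exact (intervalIntegral.integral_eq_sub_of_hasDerivAt (fun τ _ => hwt τ y hy)
        ((hcol hcwt hy).intervalIntegrable _ _)).symm
    have := (uniqueDiffOn_Icc hl x hx).eq_deriv _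
      ((hwx s x hx).sub (hwx t x hx)).hasDerivWithinAt
      (hW.hasDerivWithinAt.congr (fun y hy => hWeq hy) (hWeq hx))
    simp only [hGeq _ hx] at this
    linarith
  rw [funext hincr]
  exact ((hcol hcwtx hx).integral_hasStrictDerivAt t t).hasDerivAt.const_add _

theorem stmt_11 (l β m₀ ml k₀ kl k₃ γ α α₀ αl : ℝ)
    (hl : 0 < l) (hβ : 0 < β) (hm₀ : 0 < m₀) (hml : 0 < ml)
    (hk₀ : 0 < k₀) (hkl : 0 < kl) (hk₃ : 0 < k₃)
    (hγ : 0 ≤ γ) (hα : 0 ≤ α) (hα₀ : 0 ≤ α₀) (hαl : 0 ≤ αl)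
    (w wt wx wtt wtx wxx wtxx : ℝ → ℝ → ℝ)
    -- partial derivatives of the three times continuously differentiable w on ℝ × [0,l]
    (hwt : ∀ t : ℝ, ∀ x ∈ Set.Icc (0:ℝ) l, HasDerivAt (fun s => w s x) (wt t x) t)
    (hwx : ∀ t : ℝ, ∀ x ∈ Set.Icc (0:ℝ) l, HasDerivAt (fun y => w t y) (wx t x) x)
    (hwtt : ∀ t : ℝ, ∀ x ∈ Set.Icc (0:ℝ) l, HasDerivAt (fun s => wt s x) (wtt t x) t)
    (hwtx : ∀ t : ℝ, ∀ x ∈ Set.Icc (0:ℝ) l, HasDerivAt (fun y => wt t y) (wtx t x) x)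
    (hwxx : ∀ t : ℝ, ∀ x ∈ Set.Icc (0:ℝ) l, HasDerivAt (fun y => wx t y) (wxx t x) x)
    (hwtxx : ∀ t : ℝ, ∀ x ∈ Set.Icc (0:ℝ) l, HasDerivAt (fun y => wtx t y) (wtxx t x) x)
    (hcw : ContinuousOn (fun q : ℝ × ℝ => w q.1 q.2) (Set.univ ×ˢ Set.Icc (0:ℝ) l))
    (hcwt : ContinuousOn (fun q : ℝ × ℝ => wt q.1 q.2) (Set.univ ×ˢ Set.Icc (0:ℝ) l))
    (hcwx : ContinuousOn (fun q : ℝ × ℝ => wx q.1 q.2) (Set.univ ×ˢ Set.Icc (0:ℝ) l))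
    (hcwtt : ContinuousOn (fun q : ℝ × ℝ => wtt q.1 q.2) (Set.univ ×ˢ Set.Icc (0:ℝ) l))
    (hcwtx : ContinuousOn (fun q : ℝ × ℝ => wtx q.1 q.2) (Set.univ ×ˢ Set.Icc (0:ℝ) l))
    (hcwxx : ContinuousOn (fun q : ℝ × ℝ => wxx q.1 q.2) (Set.univ ×ˢ Set.Icc (0:ℝ) l))
    (hcwtxx : ContinuousOn (fun q : ℝ × ℝ => wtxx q.1 q.2) (Set.univ ×ˢ Set.Icc (0:ℝ) l))
    -- (i) the damped wave equation in the interior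
    (hpde : ∀ t : ℝ, ∀ x ∈ Set.Icc (0:ℝ) l,
      wtt t x + α * wt t x = γ * wtxx t x + β ^ 2 * wxx t x)
    -- (ii) the dynamic boundary condition at x = 0
    (hbc0 : ∀ t : ℝ,
      m₀ * wtt t 0 + α₀ * wt t 0 + k₀ * w t 0 = γ * wtx t 0 + β ^ 2 * wx t 0)
    -- (iii) the dynamic boundary condition at x = l
    (hbcl : ∀ t : ℝ,
      ml * wtt t l + αl * wt t l + kl * w t l =
        -(γ * wtx t l) - β ^ 2 * wx t l - k₃ * (w t l) ^ 3)
    -- the energy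
    (E : ℝ → ℝ)
    (hE : ∀ t : ℝ, E t =
      (1 / 2) * (∫ x in (0:ℝ)..l, (wt t x) ^ 2) + (ml / 2) * (wt t l) ^ 2 +
        (m₀ / 2) * (wt t 0) ^ 2 + (β ^ 2 / 2) * (∫ x in (0:ℝ)..l, (wx t x) ^ 2) +
        (kl / 2) * (w t l) ^ 2 + (k₀ / 2) * (w t 0) ^ 2 + (k₃ / 4) * (w t l) ^ 4) :
    (∀ t : ℝ, HasDerivAt E
        (-(γ * (∫ x in (0:ℝ)..l, (wtx t x) ^ 2) + α * (∫ x in (0:ℝ)..l, (wt t x) ^ 2) +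
            α₀ * (wt t 0) ^ 2 + αl * (wt t l) ^ 2)) t) ∧
    (∀ t : ℝ,
      -(γ * (∫ x in (0:ℝ)..l, (wtx t x) ^ 2) + α * (∫ x in (0:ℝ)..l, (wt t x) ^ 2) +
          α₀ * (wt t 0) ^ 2 + αl * (wt t l) ^ 2) ≤ 0) ∧
    Antitone E := by
  have h0 : (0 : ℝ) ∈ Set.Icc 0 l := ⟨le_rfl, hl.le⟩
  have hl' : l ∈ Set.Icc 0 l := ⟨hl.le, le_rfl⟩
  have huIcc : Set.uIcc 0 l = Set.Icc 0 l := Set.uIcc_of_le hl.le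
  have hrow {g : ℝ → ℝ → ℝ} (hg : ContinuousOn (fun q : ℝ × ℝ => g q.1 q.2)
      (Set.univ ×ˢ Set.Icc 0 l)) (t : ℝ) : ContinuousOn (g t) (Set.uIcc 0 l) :=
    hg.comp (f := fun x => (t, x)) (by fun_prop) fun x hx => ⟨Set.mem_univ _, huIcc ▸ hx⟩
  have hsq {g g' : ℝ → ℝ → ℝ}
      (hg : ContinuousOn (fun q : ℝ × ℝ => g q.1 q.2) (Set.univ ×ˢ Set.Icc 0 l))
      (hg' : ContinuousOn (fun q : ℝ × ℝ => g' q.1 q.2) (Set.univ ×ˢ Set.Icc 0 l))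
      (hd : ∀ t, ∀ x ∈ Set.Icc 0 l, HasDerivAt (fun s => g s x) (g' t x) t) (t : ℝ) :
      HasDerivAt (fun s => ∫ x in (0 : ℝ)..l, (g s x) ^ 2)
        (∫ x in (0 : ℝ)..l, 2 * g t x * g' t x) t := by
    refine hasDerivAt_intervalIntegral_of_continuousOn_deriv (f := fun s x => (g s x) ^ 2)
      (f' := fun s x => 2 * g s x * g' s x) (fun s => (hrow hg s).pow 2) ?_ ?_ t
    · rw [huIcc]
      exact (continuousOn_const.mul hg).mul hg'
    · intro s x hx
      simpa using (hd s x (huIcc ▸ hx)).fun_pow 2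
  have hdE (t : ℝ) : HasDerivAt E
      (-(γ * (∫ x in (0:ℝ)..l, (wtx t x) ^ 2) + α * (∫ x in (0:ℝ)..l, (wt t x) ^ 2) +
          α₀ * (wt t 0) ^ 2 + αl * (wt t l) ^ 2)) t := by
    have hwt_c := hrow hcwt t
    have hwx_c := hrow hcwx t
    have hwtt_c := hrow hcwtt t
    have hwtx_c := hrow hcwtx t
    have hwxx_c := hrow hcwxx t
    have hwtxx_c := hrow hcwtxx t
    have hparts := intervalIntegral.integral_eq_sub_of_hasDerivAt (a := 0) (b := l)
      (f := fun x => wt t x * (γ * wtx t x + β ^ 2 * wx t x))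
      (f' := fun x => wtx t x * (γ * wtx t x + β ^ 2 * wx t x)
        + wt t x * (γ * wtxx t x + β ^ 2 * wxx t x))
      (fun x hx => (hwtx t x (huIcc ▸ hx)).mul
        (((hwtxx t x (huIcc ▸ hx)).const_mul γ).add ((hwxx t x (huIcc ▸ hx)).const_mul (β ^ 2))))
      (ContinuousOn.intervalIntegrable (by fun_prop))
    have hbalance : (1 / 2) * (∫ x in (0:ℝ)..l, 2 * wt t x * wtt t x)
        + (β ^ 2 / 2) * (∫ x in (0:ℝ)..l, 2 * wx t x * wtx t x)
        + γ * (∫ x in (0:ℝ)..l, (wtx t x) ^ 2) + α * (∫ x in (0:ℝ)..l, (wt t x) ^ 2)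
        = wt t l * (γ * wtx t l + β ^ 2 * wx t l) - wt t 0 * (γ * wtx t 0 + β ^ 2 * wx t 0) := by
      rw [← hparts]
      simp only [← intervalIntegral.integral_const_mul]
      rw [← intervalIntegral.integral_add, ← intervalIntegral.integral_add,
        ← intervalIntegral.integral_add]
      · refine intervalIntegral.integral_congr fun x hx => ?_
        linear_combination wt t x * hpde t x (huIcc ▸ hx)
      all_goals exact ContinuousOn.intervalIntegrable (by fun_prop)
    rw [funext hE]
    have hderiv := ((((((((hsq hcwt hcwtt hwtt t).const_mul (1 / 2)).add
      (((hwtt t l hl').fun_pow 2).const_mul (ml / 2))).add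
      (((hwtt t 0 h0).fun_pow 2).const_mul (m₀ / 2))).add
      ((hsq hcwx hcwtx (fun s x hx =>
        hasDerivAt_swap_mixed_partial hl hwt hwx hwtx hcwt hcwtx s hx) t).const_mul
        (β ^ 2 / 2))).add
      (((hwt t l hl').fun_pow 2).const_mul (kl / 2))).add
      (((hwt t 0 h0).fun_pow 2).const_mul (k₀ / 2))).add
      (((hwt t l hl').fun_pow 4).const_mul (k₃ / 4)))
    refine hderiv.congr_deriv ?_
    push_cast
    linear_combination hbalance + wt t 0 * hbc0 t + wt t l * hbcl t
  have hnonpos (t : ℝ) :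
      -(γ * (∫ x in (0:ℝ)..l, (wtx t x) ^ 2) + α * (∫ x in (0:ℝ)..l, (wt t x) ^ 2) +
          α₀ * (wt t 0) ^ 2 + αl * (wt t l) ^ 2) ≤ 0 := by
    have h1 : 0 ≤ ∫ x in (0:ℝ)..l, (wtx t x) ^ 2 :=
      intervalIntegral.integral_nonneg hl.le fun x _ => sq_nonneg _
    have h2 : 0 ≤ ∫ x in (0:ℝ)..l, (wt t x) ^ 2 :=
      intervalIntegral.integral_nonneg hl.le fun x _ => sq_nonneg _
    rw [neg_nonpos]
    positivity
  exact ⟨hdE, hnonpos, antitone_of_hasDerivAt_nonpos hdE hnonpos⟩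
end
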